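/- arXiv:2601.16493 — 4 statements merged into one kernel-verified Lean document; each statement's English description precedes it below -/
import Mathlib

section
/- Let ν be a finite positive Borel measure on [0,1] with ν({1}) = 0. Then for all z, λ ∈ 𝔻, the Shimorin-type kernel admits the representation K_ν(z,λ) = ∫₀¹ (1/(1−r)) · ( ∫_r¹ 1/(1 − t·z·conj(λ))² dt ) dν(r). -/
open MeasureTheory Complex Set ComplexConjugate ENNReal NNReal

noncomputable section

/-- The open unit disk in ℂ. -/
def unitDisk : Set ℂ := Metric.ball 0 1

/-- Lebesgue area measure on the unit disk, normalized so that the disk has total measure 1. -/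
def dA : Measure ℂ := (ENNReal.ofReal Real.pi)⁻¹ • (volume.restrict unitDisk)

/-- The Shimorin-type kernel associated to a measure ν on [0,1]:
`K_ν(z,w) = (1 - z conj w)⁻¹ ∫₀¹ (1 - r z conj w)⁻¹ dν(r)`. -/
def Kker (ν : Measure ℝ) (z w : ℂ) : ℂ :=
  (1 - z * conj w)⁻¹ * ∫ r in Icc (0:ℝ) 1, (1 - (r : ℂ) * z * conj w)⁻¹ ∂ν

/-- The Shimorin-type integral operator `T_ν f(z) = ∫_𝔻 K_ν(z,w) f(w) dA(w)`. -/
def Tnu (ν : Measure ℝ) (f : ℂ → ℂ) (z : ℂ) : ℂ := ∫ w, Kker ν z w * f w ∂dA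

/-- The critical quantity `c_ν = sup{ c ∈ [1,2) : ∫₀¹ (1-r²)^(-2/c') dν(r) < ∞ }`,
where `2/c' = 2 - 2/c`. -/
def cnu (ν : Measure ℝ) : ℝ :=
  sSup {c : ℝ | c ∈ Ico (1:ℝ) 2 ∧
    ∫⁻ r in Icc (0:ℝ) 1, (ENNReal.ofReal (1 - r ^ 2)) ^ (-(2 - 2 / c)) ∂ν < ⊤}

theorem one_sub_ofReal_mul_ne_zero {t : ℝ} (ht : t ∈ Icc (0:ℝ) 1) {c : ℂ} (hc : ‖c‖ < 1) :
    1 - (t : ℂ) * c ≠ 0 := by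
  intro h
  have h' : ‖(t : ℂ) * c‖ = 1 := by rw [← sub_eq_zero.mp h, norm_one]
  rw [norm_mul, norm_real, Real.norm_of_nonneg ht.1] at h'
  nlinarith [norm_nonneg c, ht.2]

/-- The function `t ↦ t / (1 - t c)` is a primitive of `t ↦ (1 - t c)⁻²`. -/
theorem hasDerivAt_ofReal_mul_inv_one_sub {t : ℝ} {c : ℂ} (h : 1 - (t : ℂ) * c ≠ 0) :
    HasDerivAt (fun s : ℝ => (s : ℂ) * (1 - (s : ℂ) * c)⁻¹) ((1 - (t : ℂ) * c) ^ 2)⁻¹ t := by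
  have hid : HasDerivAt (fun s : ℝ => (s : ℂ)) 1 t := ofRealCLM.hasDerivAt
  refine (hid.fun_mul (((hid.mul_const c).const_sub 1).fun_inv h)).congr_deriv ?_
  field_simp
  ring

theorem integral_inv_one_sub_ofReal_mul_sq {r : ℝ} (hr : r ∈ Icc (0:ℝ) 1) {c : ℂ}
    (hc : ‖c‖ < 1) :
    ∫ t in r..(1:ℝ), ((1 - (t : ℂ) * c) ^ 2)⁻¹ =
      (1 - (r : ℂ)) * ((1 - c)⁻¹ * (1 - (r : ℂ) * c)⁻¹) := by
  have hne : ∀ t ∈ uIcc r 1, 1 - (t : ℂ) * c ≠ 0 := fun t ht => by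
    rw [uIcc_of_le hr.2] at ht
    exact one_sub_ofReal_mul_ne_zero ⟨hr.1.trans ht.1, ht.2⟩ hc
  have hcont : ContinuousOn (fun t : ℝ => ((1 - (t : ℂ) * c) ^ 2)⁻¹) (uIcc r 1) :=
    ContinuousOn.inv₀ (by fun_prop) fun t ht => pow_ne_zero 2 (hne t ht)
  rw [intervalIntegral.integral_eq_sub_of_hasDerivAt
    (fun t ht => hasDerivAt_ofReal_mul_inv_one_sub (hne t ht)) hcont.intervalIntegrable]
  have h₁ : 1 - c ≠ 0 := by simpa using hne 1 right_mem_uIcc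
  have hr' := hne r left_mem_uIcc
  push_cast
  rw [one_mul, one_mul]
  rw [mul_comm (r : ℂ) c] at hr' ⊢
  field_simp
  ring

/-- **Proposition (double-integral representation of the Shimorin kernel).**
If ν({1}) = 0, then for all z, w ∈ 𝔻,
`K_ν(z,w) = ∫₀¹ (1-r)⁻¹ (∫_r¹ (1 - t z conj w)⁻² dt) dν(r)`. -/
theorem shimorin_kernel_double_integral_repr
    (ν : Measure ℝ) [IsFiniteMeasure ν] (hsupp : ν (Icc (0:ℝ) 1)ᶜ = 0)
    (h1 : ν {1} = 0) (z w : ℂ) (hz : z ∈ unitDisk) (hw : w ∈ unitDisk) :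
    Kker ν z w = ∫ r in Icc (0:ℝ) 1,
      ((1 : ℝ) - r)⁻¹ • (∫ t in r..(1:ℝ), ((1 - (t : ℂ) * z * conj w) ^ 2)⁻¹) ∂ν := by
  rw [unitDisk, mem_ball_zero_iff] at hz hw
  have hc : ‖z * conj w‖ < 1 := by
    rw [norm_mul, RCLike.norm_conj]
    exact mul_lt_one_of_nonneg_of_lt_one_left (norm_nonneg z) hz hw.le
  rw [Kker, ← integral_const_mul]
  have hne : ∀ᵐ r ∂ν, r ≠ 1 := measure_eq_zero_iff_ae_notMem.mp h1
  refine integral_congr_ae ?_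
  filter_upwards [ae_restrict_mem measurableSet_Icc, ae_restrict_of_ae hne] with r hr hr1
  have hr0 : 1 - (r : ℂ) ≠ 0 := sub_ne_zero.mpr fun h => hr1 (by exact_mod_cast h.symm)
  simp only [mul_assoc]
  rw [integral_inv_one_sub_ofReal_mul_sq hr hc, real_smul]
  push_cast
  rw [inv_mul_cancel_left₀ hr0]

end
end

section
/- Let ν be a finite positive Borel measure on [0,1] with ν({1}) = 0, and let f be holomorphic on 𝔻 and integrable with respect to dA (i.e. f belongs to the Bergman space L_a^1(𝔻)). Then for every z ∈ 𝔻, T_ν f(z) = ∫₀¹ (1/(1−r)) · ( ∫_r¹ f(t·z) dt ) dν(r). -/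
open MeasureTheory Complex Set ComplexConjugate ENNReal NNReal

noncomputable section

/-- The polar coordinate change of variables preserves integrability. -/
theorem Complex.integrableOn_comp_polarCoord_symm {E : Type*} [NormedAddCommGroup E]
    [NormedSpace ℝ E] {g : ℂ → E} (hg : Integrable g) :
    IntegrableOn (fun p : ℝ × ℝ => p.1 • g (Complex.polarCoord.symm p)) _root_.polarCoord.target := by
  have hcomp : Integrable (fun p : ℝ × ℝ => g (measurableEquivRealProd.symm p)) :=
    (Complex.volume_preserving_equiv_real_prod.symm.integrable_comp_emb
      measurableEquivRealProd.symm.measurableEmbedding).2 hg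
  have h := (integrableOn_image_iff_integrableOn_abs_det_fderiv_smul volume
    _root_.polarCoord.open_target.measurableSet
    (fun p _ => (hasFDerivAt_polarCoord_symm p).hasFDerivWithinAt)
    _root_.polarCoord.symm.injOn (fun p : ℝ × ℝ => g (measurableEquivRealProd.symm p))).1
    hcomp.integrableOn
  refine h.congr_fun (fun p hp => ?_) _root_.polarCoord.open_target.measurableSet
  have hp1 : 0 < p.1 := hp.1
  simp only [det_fderivPolarCoordSymm, abs_of_pos hp1,
    measurableEquivRealProd_symm_polarCoord_symm_apply]

/-- The circle average as an integral over `(-π, π)` in polar coordinates. -/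
theorem integral_polarCoord_symm_eq_circleAverage {E : Type*} [NormedAddCommGroup E]
    [NormedSpace ℝ E] (g : ℂ → E) (ρ : ℝ) :
    ∫ θ in Ioo (-Real.pi) Real.pi, g (Complex.polarCoord.symm (ρ, θ)) =
      (2 * Real.pi) • Real.circleAverage g 0 ρ := by
  rw [Real.circleAverage_eq_integral_add (-Real.pi), smul_inv_smul₀ Real.two_pi_pos.ne',
    intervalIntegral.integral_comp_add_right (fun θ => g (circleMap 0 ρ θ)),
    intervalIntegral.integral_of_le (by linarith [Real.pi_pos]), integral_Ioc_eq_integral_Ioo]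
  have hpi : 2 * Real.pi + -Real.pi = Real.pi := by ring
  rw [zero_add, hpi]
  refine integral_congr_ae (.of_forall fun θ => ?_)
  simp [circleMap, Complex.exp_mul_I]

/-- Area integrals over the plane as radial integrals of circle averages. -/
theorem integral_eq_integral_circleAverage {E : Type*} [NormedAddCommGroup E]
    [NormedSpace ℝ E] {g : ℂ → E} (hg : Integrable g) :
    ∫ w, g w = ∫ ρ in Ioi (0 : ℝ), (2 * Real.pi * ρ) • Real.circleAverage g 0 ρ := by
  rw [← Complex.integral_comp_polarCoord_symm, polarCoord_target]
  have h := Complex.integrableOn_comp_polarCoord_symm hg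
  rw [polarCoord_target] at h
  refine (setIntegral_prod _ h).trans ?_
  refine integral_congr_ae (.of_forall fun ρ => ?_)
  simp only
  rw [integral_smul, integral_polarCoord_symm_eq_circleAverage, smul_smul, mul_comm]

/-- Area integrals over the unit disk as radial integrals of circle averages. -/
theorem setIntegral_unitDisk_eq_integral_circleAverage {E : Type*} [NormedAddCommGroup E]
    [NormedSpace ℝ E] {h : ℂ → E} (hh : IntegrableOn h unitDisk) :
    ∫ w in unitDisk, h w =
      ∫ ρ in Ioo (0 : ℝ) 1, (2 * Real.pi * ρ) • Real.circleAverage h 0 ρ := by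
  have hmeas : MeasurableSet unitDisk := measurableSet_ball
  rw [← integral_indicator hmeas,
    integral_eq_integral_circleAverage ((integrable_indicator_iff hmeas).2 hh),
    ← Ioi_inter_Iio, ← setIntegral_indicator measurableSet_Iio]
  refine setIntegral_congr_fun measurableSet_Ioi fun ρ hρ => ?_
  have hρ' : 0 < ρ := hρ
  by_cases h1 : ρ < 1
  · rw [indicator_of_mem (mem_Iio.2 h1)]
    congr 1
    refine Real.circleAverage_congr_sphere fun w hw => indicator_of_mem ?_ _
    rw [abs_of_pos hρ', mem_sphere_zero_iff_norm] at hw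
    simp [unitDisk, hw, h1]
  · rw [indicator_of_notMem (by simpa using h1)]
    have hz : Real.circleAverage (unitDisk.indicator h) 0 ρ
        = Real.circleAverage (fun _ => (0 : E)) 0 ρ := by
      refine Real.circleAverage_congr_sphere fun w hw => indicator_of_notMem ?_ _
      rw [abs_of_pos hρ', mem_sphere_zero_iff_norm] at hw
      simp only [unitDisk, mem_ball_zero_iff, hw]
      exact h1
    rw [hz]
    simp [Real.circleAverage]

theorem one_sub_norm_le_norm_one_sub_mul_conj {z w : ℂ} (hw : w ∈ unitDisk) :
    1 - ‖z‖ ≤ ‖1 - z * conj w‖ := by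
  have hw' : ‖w‖ < 1 := by simpa [unitDisk] using hw
  have h := norm_sub_norm_le (1 : ℂ) (z * conj w)
  rw [norm_one, norm_mul, RCLike.norm_conj] at h
  nlinarith [norm_nonneg z, norm_nonneg w]

theorem norm_inv_one_sub_mul_conj_le {z w : ℂ} (hz : ‖z‖ < 1) (hw : w ∈ unitDisk) :
    ‖(1 - z * conj w)⁻¹‖ ≤ (1 - ‖z‖)⁻¹ := by
  rw [norm_inv]
  exact inv_anti₀ (by linarith) (one_sub_norm_le_norm_one_sub_mul_conj hw)

theorem one_sub_mul_conj_ne_zero {z w : ℂ} (hz : ‖z‖ < 1) (hw : w ∈ unitDisk) :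
    1 - z * conj w ≠ 0 := by
  rw [← norm_pos_iff]
  linarith [one_sub_norm_le_norm_one_sub_mul_conj (z := z) hw]

theorem ofReal_mul_mem_unitDisk {z : ℂ} (hz : ‖z‖ < 1) {t : ℝ} (ht : t ∈ Icc (0 : ℝ) 1) :
    (t : ℂ) * z ∈ unitDisk := by
  simp only [unitDisk, mem_ball_zero_iff, norm_mul, norm_real, Real.norm_eq_abs, abs_of_nonneg ht.1]
  nlinarith [norm_nonneg z, ht.1, ht.2]

theorem continuousOn_comp_ofReal_mul {f : ℂ → ℂ} (hf : ContinuousOn f unitDisk) {z : ℂ}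
    (hz : ‖z‖ < 1) : ContinuousOn (fun t : ℝ => f ((t : ℂ) * z)) (Icc 0 1) :=
  hf.comp (by fun_prop) fun _ ht => ofReal_mul_mem_unitDisk hz ht

theorem intervalIntegrable_comp_ofReal_mul {f : ℂ → ℂ} (hf : ContinuousOn f unitDisk) {z : ℂ}
    (hz : ‖z‖ < 1) {a b : ℝ} (ha : a ∈ Icc (0 : ℝ) 1) (hb : b ∈ Icc (0 : ℝ) 1) :
    IntervalIntegrable (fun t : ℝ => f ((t : ℂ) * z)) volume a b :=
  ((continuousOn_comp_ofReal_mul hf hz).mono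
    (uIcc_subset_Icc ha hb)).intervalIntegrable

theorem integrableOn_inv_one_sub_mul_conj_mul {f : ℂ → ℂ} (hfi : IntegrableOn f unitDisk) {z : ℂ}
    (hz : ‖z‖ < 1) : IntegrableOn (fun w => (1 - z * conj w)⁻¹ * f w) unitDisk := by
  refine Integrable.bdd_mul (c := (1 - ‖z‖)⁻¹) hfi ?_ ?_
  · have : Measurable fun w : ℂ => (1 - z * conj w)⁻¹ :=
      (measurable_const.sub
        (measurable_const.mul Complex.continuous_conj.measurable)).inv
    exact this.aestronglyMeasurable
  · filter_upwards [ae_restrict_mem measurableSet_ball] with w hw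
    exact norm_inv_one_sub_mul_conj_le hz hw

theorem circleAverage_inv_one_sub_mul_conj_mul {f : ℂ → ℂ} (hf : DifferentiableOn ℂ f unitDisk)
    {z : ℂ} (hz : ‖z‖ < 1) {ρ : ℝ} (hρ : ρ ∈ Ioo (0 : ℝ) 1) :
    Real.circleAverage (fun w => (1 - z * conj w)⁻¹ * f w) 0 ρ = f (((ρ ^ 2 : ℝ) : ℂ) * z) := by
  have hρ0 : 0 < ρ := hρ.1
  have hsub : Metric.closedBall (0 : ℂ) ρ ⊆ unitDisk := Metric.closedBall_subset_ball hρ.2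
  have hd : DiffContOnCl ℂ f (Metric.ball 0 |ρ|) := by
    rw [abs_of_pos hρ0]
    exact (hf.mono (by rw [closure_ball _ hρ0.ne']; exact hsub)).diffContOnCl
  have hmem : ((ρ ^ 2 : ℝ) : ℂ) * z ∈ Metric.ball (0 : ℂ) |ρ| := by
    rw [abs_of_pos hρ0, mem_ball_zero_iff, norm_mul, norm_real, Real.norm_eq_abs,
      abs_of_pos (by positivity)]
    nlinarith [norm_nonneg z, hρ.2]
  rw [← hd.circleAverage_smul_div hmem]
  refine Real.circleAverage_congr_sphere fun w hw => ?_
  rw [abs_of_pos hρ0] at hw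
  have hnorm : w * conj w = ((ρ ^ 2 : ℝ) : ℂ) := by
    rw [Complex.mul_conj, Complex.normSq_eq_norm_sq, mem_sphere_zero_iff_norm.1 hw]
  have hw0 : w ≠ 0 := by
    rintro rfl
    simp [hρ0.ne] at hw
  have hne := one_sub_mul_conj_ne_zero hz (hsub (Metric.sphere_subset_closedBall hw))
  have hfac : w - ((ρ ^ 2 : ℝ) : ℂ) * z = w * (1 - z * conj w) := by
    rw [← hnorm]; ring
  simp only [sub_zero, smul_eq_mul, hfac]
  field_simp

/-- The area integral against the Cauchy-type kernel `(1 - z conj w)⁻¹` of an integrable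
holomorphic function is a radial average. -/
theorem integral_inv_one_sub_mul_conj_mul {f : ℂ → ℂ} (hf : DifferentiableOn ℂ f unitDisk)
    (hfi : IntegrableOn f unitDisk) {z : ℂ} (hz : ‖z‖ < 1) :
    ∫ w in unitDisk, (1 - z * conj w)⁻¹ * f w =
      Real.pi * ∫ s in (0 : ℝ)..1, f ((s : ℂ) * z) := by
  rw [setIntegral_unitDisk_eq_integral_circleAverage (integrableOn_inv_one_sub_mul_conj_mul hfi hz)]
  have hsubst := intervalIntegral.integral_deriv_smul_comp' (a := 0) (b := 1)
    (f := fun ρ : ℝ => ρ ^ 2) (f' := fun ρ => 2 * ρ) (g := fun s : ℝ => f ((s : ℂ) * z))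
    (fun ρ _ => by simpa using hasDerivAt_pow 2 ρ) (by fun_prop)
    ((continuousOn_comp_ofReal_mul hf.continuousOn hz).mono (by
      rintro _ ⟨ρ, hρ, rfl⟩
      rw [uIcc_of_le zero_le_one] at hρ
      exact ⟨by positivity, pow_le_one₀ hρ.1 hρ.2⟩))
  norm_num at hsubst
  rw [← hsubst, intervalIntegral.integral_of_le zero_le_one, integral_Ioc_eq_integral_Ioo,
    ← integral_const_mul]
  refine setIntegral_congr_fun measurableSet_Ioo fun ρ hρ => ?_
  rw [circleAverage_inv_one_sub_mul_conj_mul hf hz hρ, Complex.real_smul]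
  push_cast
  ring

theorem integral_dA (g : ℂ → ℂ) : ∫ w, g w ∂dA = (Real.pi : ℂ)⁻¹ * ∫ w in unitDisk, g w := by
  rw [dA, integral_smul_measure, ENNReal.toReal_inv, ENNReal.toReal_ofReal Real.pi_pos.le,
    Complex.real_smul, Complex.ofReal_inv]

theorem ae_mem_unitDisk_dA : ∀ᵐ w ∂dA, w ∈ unitDisk :=
  Measure.ae_smul_measure (ae_restrict_mem measurableSet_ball) _

theorem integrableOn_unitDisk_of_integrable_dA {g : ℂ → ℂ} (hg : Integrable g dA) :
    IntegrableOn g unitDisk :=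
  (integrable_smul_measure (ENNReal.inv_ne_zero.2 ENNReal.ofReal_ne_top)
    (ENNReal.inv_ne_top.2 (by simp [Real.pi_pos]))).1 hg

/-- The Shimorin-type operator associated with the Dirac measure at `r < 1`. -/
theorem integral_shimorin_kernel_dirac {f : ℂ → ℂ} (hf : DifferentiableOn ℂ f unitDisk)
    (hfi : Integrable f dA) {z : ℂ} (hz : ‖z‖ < 1) {r : ℝ} (hr : r ∈ Ico (0 : ℝ) 1) :
    ∫ w, (1 - z * conj w)⁻¹ * (1 - (r : ℂ) * z * conj w)⁻¹ * f w ∂dA =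
      ((1 : ℝ) - r)⁻¹ • ∫ t in r..(1 : ℝ), f ((t : ℂ) * z) := by
  have hfi' := integrableOn_unitDisk_of_integrable_dA hfi
  have hr' : r ∈ Icc (0 : ℝ) 1 := ⟨hr.1, hr.2.le⟩
  have hrz : ‖(r : ℂ) * z‖ < 1 := by simpa [unitDisk] using ofReal_mul_mem_unitDisk hz hr'
  have hr1 : (1 : ℂ) - r ≠ 0 := by
    rw [← Complex.ofReal_one, ← Complex.ofReal_sub, Complex.ofReal_ne_zero]
    linarith [hr.2]
  have hpf : ∀ w ∈ unitDisk, (1 - z * conj w)⁻¹ * (1 - (r : ℂ) * z * conj w)⁻¹ * f w =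
      ((1 : ℂ) - r)⁻¹ * ((1 - z * conj w)⁻¹ * f w - r * ((1 - (r : ℂ) * z * conj w)⁻¹ * f w)) := by
    intro w hw
    have h1 := one_sub_mul_conj_ne_zero hz hw
    have h2 := one_sub_mul_conj_ne_zero hrz hw
    have hlin : (1 : ℂ) - r = (1 - (r : ℂ) * z * conj w) - r * (1 - z * conj w) := by ring
    rw [eq_inv_mul_iff_mul_eq₀ hr1, hlin]
    generalize 1 - z * conj w = a at h1 ⊢
    generalize 1 - (r : ℂ) * z * conj w = b at h2 ⊢
    field_simp
  have hscale : (r : ℂ) * ∫ s in (0 : ℝ)..1, f ((s : ℂ) * (r * z)) =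
      ∫ t in (0 : ℝ)..r, f ((t : ℂ) * z) := by
    have h := intervalIntegral.smul_integral_comp_mul_left (a := 0) (b := 1)
      (fun t : ℝ => f ((t : ℂ) * z)) r
    simp only [mul_zero, mul_one, Complex.real_smul] at h
    rw [← h]
    congr 1
    refine intervalIntegral.integral_congr fun s _ => ?_
    push_cast
    ring_nf
  have hsplit := intervalIntegral.integral_interval_sub_left
    (intervalIntegrable_comp_ofReal_mul hf.continuousOn hz (a := 0) (b := 1) (by simp) (by simp))
    (intervalIntegrable_comp_ofReal_mul hf.continuousOn hz (a := 0) (b := r) (by simp) hr')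
  rw [integral_dA, setIntegral_congr_fun (s := unitDisk) measurableSet_ball hpf, integral_const_mul,
    integral_sub (integrableOn_inv_one_sub_mul_conj_mul hfi' hz)
      ((integrableOn_inv_one_sub_mul_conj_mul hfi' hrz).const_mul _),
    integral_const_mul, integral_inv_one_sub_mul_conj_mul hf hfi' hz,
    integral_inv_one_sub_mul_conj_mul hf hfi' hrz, ← hsplit, ← hscale, Complex.real_smul]
  have hpi : (Real.pi : ℂ) ≠ 0 := ofReal_ne_zero.2 Real.pi_ne_zero
  push_cast
  rw [mul_left_comm, mul_left_comm (r : ℂ), ← mul_sub, inv_mul_cancel_left₀ hpi]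

/-- **Corollary (action of T_ν on Bergman-space functions).**
If ν({1}) = 0 and f is holomorphic on 𝔻 and integrable with respect to dA
(i.e. f ∈ L¹_a(𝔻)), then for every z ∈ 𝔻,
`T_ν f(z) = ∫₀¹ (1-r)⁻¹ (∫_r¹ f(tz) dt) dν(r)`. -/
theorem shimorin_operator_on_Bergman_functions
    (ν : Measure ℝ) [IsFiniteMeasure ν] (hsupp : ν (Icc (0:ℝ) 1)ᶜ = 0)
    (h1 : ν {1} = 0) (f : ℂ → ℂ)
    (hf : DifferentiableOn ℂ f unitDisk) (hfi : Integrable f dA)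
    (z : ℂ) (hz : z ∈ unitDisk) :
    Tnu ν f z = ∫ r in Icc (0:ℝ) 1,
      ((1 : ℝ) - r)⁻¹ • (∫ t in r..(1:ℝ), f ((t : ℂ) * z)) ∂ν := by
  have hz' : ‖z‖ < 1 := by simpa [unitDisk] using hz
  have hsf : SFinite dA := by unfold dA; infer_instance
  have hr_mem : ∀ᵐ r ∂ν.restrict (Icc (0 : ℝ) 1), r ∈ Ico (0 : ℝ) 1 := by
    have hne : ∀ᵐ r ∂ν.restrict (Icc (0 : ℝ) 1), r ≠ 1 :=
      ae_restrict_of_ae (measure_eq_zero_iff_ae_notMem.1 h1)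
    filter_upwards [ae_restrict_mem measurableSet_Icc, hne] with r hr hr1
    exact ⟨hr.1, lt_of_le_of_ne hr.2 hr1⟩
  have hmeas : Measurable fun p : ℂ × ℝ =>
      (1 - z * conj p.1)⁻¹ * (1 - (p.2 : ℂ) * z * conj p.1)⁻¹ := by
    have hconj : Measurable fun p : ℂ × ℝ => conj p.1 :=
      Complex.continuous_conj.measurable.comp measurable_fst
    have hcoe : Measurable fun p : ℂ × ℝ => (p.2 : ℂ) :=
      Complex.measurable_ofReal.comp measurable_snd
    exact (measurable_const.sub (measurable_const.mul hconj)).inv.mul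
      (measurable_const.sub ((hcoe.mul measurable_const).mul hconj)).inv
  have hint : Integrable (Function.uncurry fun (w : ℂ) (r : ℝ) =>
      (1 - z * conj w)⁻¹ * (1 - (r : ℂ) * z * conj w)⁻¹ * f w)
      (dA.prod (ν.restrict (Icc (0 : ℝ) 1))) := by
    refine Integrable.bdd_mul (c := (1 - ‖z‖)⁻¹ * (1 - ‖z‖)⁻¹) (hfi.comp_fst _)
      hmeas.aestronglyMeasurable ?_
    filter_upwards [Measure.quasiMeasurePreserving_fst.ae ae_mem_unitDisk_dA,
      Measure.quasiMeasurePreserving_snd.ae hr_mem] with p hw hr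
    have hle : ‖(p.2 : ℂ) * z‖ ≤ ‖z‖ := by
      rw [norm_mul, norm_real, Real.norm_eq_abs, abs_of_nonneg hr.1]
      exact mul_le_of_le_one_left (norm_nonneg z) hr.2.le
    have hpos : 0 < 1 - ‖z‖ := by linarith
    rw [norm_mul]
    exact mul_le_mul (norm_inv_one_sub_mul_conj_le hz' hw)
      ((norm_inv_one_sub_mul_conj_le (hle.trans_lt hz') hw).trans
        (inv_anti₀ hpos (by linarith)))
      (norm_nonneg _) (inv_nonneg.2 hpos.le)
  have hT : Tnu ν f z = ∫ w, ∫ r in Icc (0 : ℝ) 1,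
      (1 - z * conj w)⁻¹ * (1 - (r : ℂ) * z * conj w)⁻¹ * f w ∂ν ∂dA := by
    refine integral_congr_ae (.of_forall fun w => ?_)
    simp only [Kker]
    rw [integral_mul_const, integral_const_mul]
  rw [hT, integral_integral_swap hint]
  refine integral_congr_ae ?_
  filter_upwards [hr_mem] with r hr
  exact integral_shimorin_kernel_dirac hf hfi hz' hr

end
end

section
/- Let ν be a finite positive Borel measure on [0,1] with ν({1}) = 0, and suppose 0 < s₀ < 1, where s₀ = sup{ s ∈ [0,1) : ∫₀¹ (1−r)^{−s} dν(r) < ∞ }. Then limsup_{n→∞} (log m_n)/(log(n+1)) = −s₀. -/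
open MeasureTheory Set ENNReal

noncomputable section

/-- The coefficient multiplier sequence of the Shimorin-type operator:
`m_n = (1/(n+1)) ∫₀¹ (1 - r^{n+1})/(1 - r) dν(r)`. -/
def mseq (ν : Measure ℝ) (n : ℕ) : ℝ :=
  (1 / (n + 1)) * ∫ r in Icc (0:ℝ) 1, (1 - r ^ (n + 1)) / (1 - r) ∂ν

/-- `s₀ = sup{ s ∈ [0,1) : ∫₀¹ (1-r)^{-s} dν(r) < ∞ }`. -/
def sZero (ν : Measure ℝ) : ℝ :=
  sSup {s : ℝ | s ∈ Ico (0:ℝ) 1 ∧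
    ∫⁻ r in Icc (0:ℝ) 1, (ENNReal.ofReal (1 - r)) ^ (-s) ∂ν < ⊤}

/-- The kernel whose integral against `ν` is `mseq ν n`, with `N = n + 1`. -/
def avgKernel (N : ℕ) (r : ℝ) : ℝ := (1 - r ^ N) / (1 - r) / N

lemma measurable_avgKernel (N : ℕ) : Measurable (avgKernel N) := by
  unfold avgKernel; fun_prop

lemma avgKernel_nonneg (N : ℕ) {r : ℝ} (hr : r ∈ Icc (0:ℝ) 1) : 0 ≤ avgKernel N r := by
  have := pow_le_one₀ (n := N) hr.1 hr.2
  have h2 := hr.2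
  unfold avgKernel
  apply div_nonneg (div_nonneg _ _) (Nat.cast_nonneg N) <;> linarith

lemma avgKernel_le_one {N : ℕ} (hN : 0 < N) {r : ℝ} (hr : r ∈ Icc (0:ℝ) 1) :
    avgKernel N r ≤ 1 := by
  unfold avgKernel
  have hN' : (0:ℝ) < N := by exact_mod_cast hN
  rcases hr.2.eq_or_lt with h | h
  · simp [h]
  · rw [div_le_one hN', div_le_iff₀ (by linarith)]
    have := one_add_mul_sub_le_pow (a := r) (by linarith [hr.1]) N
    linarith

lemma avgKernel_le_inv {N : ℕ} (hN : 0 < N) {r : ℝ} (hr : r ∈ Ico (0:ℝ) 1) :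
    avgKernel N r ≤ (N * (1 - r))⁻¹ := by
  have hN' : (0:ℝ) < N := by exact_mod_cast hN
  have h : 0 < 1 - r := by linarith [hr.2]
  have := pow_nonneg hr.1 N
  unfold avgKernel
  rw [div_div, inv_eq_one_div, mul_comm (1 - r)]
  gcongr
  linarith

lemma avgKernel_le_rpow {N : ℕ} (hN : 0 < N) {r s : ℝ} (hr : r ∈ Ico (0:ℝ) 1)
    (hs : s ∈ Ico (0:ℝ) 1) : avgKernel N r ≤ (N:ℝ) ^ (-s) * (1 - r) ^ (-s) := by
  have hN' : (0:ℝ) < N := by exact_mod_cast hN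
  have h : 0 < 1 - r := by linarith [hr.2]
  rw [← Real.mul_rpow hN'.le h.le]
  have hp : 0 < N * (1 - r) := mul_pos hN' h
  rcases le_total (N * (1 - r)) 1 with h1 | h1
  · exact (avgKernel_le_one hN ⟨hr.1, hr.2.le⟩).trans
      (Real.one_le_rpow_of_pos_of_le_one_of_nonpos hp h1 (by linarith [hs.1]))
  · refine (avgKernel_le_inv hN hr).trans ?_
    rw [← Real.rpow_neg_one]
    exact Real.rpow_le_rpow_of_exponent_le h1 (by linarith [hs.2])

lemma inv_le_avgKernel {N : ℕ} (hN : 0 < N) {r : ℝ} (hr : r ∈ Ico (0:ℝ) 1) :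
    (N:ℝ)⁻¹ ≤ avgKernel N r := by
  have h : 0 < 1 - r := by linarith [hr.2]
  unfold avgKernel
  rw [inv_eq_one_div]
  gcongr
  rw [one_le_div h]
  have := pow_le_of_le_one hr.1 hr.2.le hN.ne'
  linarith

lemma half_le_avgKernel {N : ℕ} (hN : 0 < N) {r : ℝ} (hr : r ∈ Ico (0:ℝ) 1)
    (h : N * (1 - r) ≤ 1) : 1 / 2 ≤ avgKernel N r := by
  have hN' : (0:ℝ) < N := by exact_mod_cast hN
  have hx : 0 < 1 - r := by linarith [hr.2]
  have hp : 0 < N * (1 - r) := mul_pos hN' hx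
  have hb : 1 + N * (1 - r) ≤ (1 + (1 - r)) ^ N := one_add_mul_le_pow (by linarith) N
  have hm : r ^ N * (1 + (1 - r)) ^ N ≤ 1 := by
    rw [← mul_pow]
    exact pow_le_one₀ (mul_nonneg hr.1 (by linarith)) (by nlinarith)
  have h0 := pow_nonneg hr.1 N
  have hq : r ^ N * (1 + N * (1 - r)) ≤ 1 := (mul_le_mul_of_nonneg_left hb h0).trans hm
  unfold avgKernel
  rw [div_div, le_div_iff₀ (by positivity)]
  nlinarith

lemma ae_mem_Ico {ν : Measure ℝ} (h1 : ν {1} = 0) :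
    ∀ᵐ r ∂ν.restrict (Icc (0:ℝ) 1), r ∈ Ico (0:ℝ) 1 := by
  have h : ∀ᵐ r ∂ν, r ≠ 1 := by simpa [ae_iff] using h1
  filter_upwards [ae_restrict_of_ae h, ae_restrict_mem measurableSet_Icc] with r hr hr'
  exact ⟨hr'.1, lt_of_le_of_ne hr'.2 hr⟩

lemma integrableOn_avgKernel (ν : Measure ℝ) [IsFiniteMeasure ν] {N : ℕ} (hN : 0 < N) :
    IntegrableOn (avgKernel N) (Icc (0:ℝ) 1) ν := by
  refine Measure.integrableOn_of_bounded (M := 1) (measure_ne_top _ _)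
    (measurable_avgKernel N).aestronglyMeasurable ?_
  filter_upwards [ae_restrict_mem measurableSet_Icc] with r hr
  rw [Real.norm_of_nonneg (avgKernel_nonneg N hr)]
  exact avgKernel_le_one hN hr

lemma mseq_eq_integral_avgKernel (ν : Measure ℝ) (n : ℕ) :
    mseq ν n = ∫ r in Icc (0:ℝ) 1, avgKernel (n + 1) r ∂ν := by
  unfold mseq avgKernel
  rw [integral_div]
  push_cast
  ring

lemma mseq_nonneg (ν : Measure ℝ) (n : ℕ) : 0 ≤ mseq ν n := by
  rw [mseq_eq_integral_avgKernel]
  exact setIntegral_nonneg measurableSet_Icc fun r hr => avgKernel_nonneg _ hr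

lemma ofReal_mseq (ν : Measure ℝ) [IsFiniteMeasure ν] (n : ℕ) :
    ENNReal.ofReal (mseq ν n) =
      ∫⁻ r in Icc (0:ℝ) 1, ENNReal.ofReal (avgKernel (n + 1) r) ∂ν := by
  rw [mseq_eq_integral_avgKernel]
  refine ofReal_integral_eq_lintegral_ofReal (integrableOn_avgKernel ν n.succ_pos) ?_
  filter_upwards [ae_restrict_mem measurableSet_Icc] with r hr using avgKernel_nonneg _ hr

lemma mseq_le_rpow {ν : Measure ℝ} [IsFiniteMeasure ν] (h1 : ν {1} = 0) {s : ℝ}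
    (hs : s ∈ Ico (0:ℝ) 1)
    (hI : ∫⁻ r in Icc (0:ℝ) 1, (ENNReal.ofReal (1 - r)) ^ (-s) ∂ν < ⊤) :
    ∃ C : ℝ, 0 < C ∧ ∀ n : ℕ, mseq ν n ≤ C * ((n : ℝ) + 1) ^ (-s) := by
  set I := ∫⁻ r in Icc (0:ℝ) 1, (ENNReal.ofReal (1 - r)) ^ (-s) ∂ν
  refine ⟨I.toReal + 1, by positivity, fun n => ?_⟩
  have hn : (0:ℝ) < n + 1 := by positivity
  have key : ENNReal.ofReal (mseq ν n) ≤ ENNReal.ofReal (((n : ℝ) + 1) ^ (-s)) * I := by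
    rw [ofReal_mseq, ← lintegral_const_mul' _ _ ofReal_ne_top]
    refine lintegral_mono_ae ?_
    filter_upwards [ae_mem_Ico h1] with r hr
    have hr' : 0 < 1 - r := by linarith [hr.2]
    rw [ENNReal.ofReal_rpow_of_pos hr', ← ENNReal.ofReal_mul (by positivity)]
    apply ENNReal.ofReal_le_ofReal
    simpa using avgKernel_le_rpow n.succ_pos hr hs
  rw [← ENNReal.ofReal_toReal hI.ne, ← ENNReal.ofReal_mul (by positivity),
    ENNReal.ofReal_le_ofReal_iff (by positivity)] at key
  have : 0 < ((n : ℝ) + 1) ^ (-s) := by positivity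
  linarith

lemma sZero_eq_one_of_measure_zero {ν : Measure ℝ} (h : ν (Icc (0:ℝ) 1) = 0) :
    sZero ν = 1 := by
  have : ν.restrict (Icc (0:ℝ) 1) = 0 := Measure.restrict_eq_zero.2 h
  unfold sZero
  simp only [this, lintegral_zero_measure, zero_lt_top, and_true]
  exact csSup_Ico one_pos

lemma mseq_pos {ν : Measure ℝ} [IsFiniteMeasure ν] (h1 : ν {1} = 0) (hs1 : sZero ν < 1)
    (n : ℕ) : 0 < mseq ν n := by
  have hν : ν (Icc (0:ℝ) 1) ≠ 0 := fun h => hs1.ne (sZero_eq_one_of_measure_zero h)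
  rw [← ENNReal.ofReal_pos, ofReal_mseq]
  have hle : ∫⁻ _ in Icc (0:ℝ) 1, ENNReal.ofReal (((n + 1 : ℕ) : ℝ)⁻¹) ∂ν ≤
      ∫⁻ r in Icc (0:ℝ) 1, ENNReal.ofReal (avgKernel (n + 1) r) ∂ν := by
    refine lintegral_mono_ae ?_
    filter_upwards [ae_mem_Ico h1] with r hr
    exact ENNReal.ofReal_le_ofReal (inv_le_avgKernel n.succ_pos hr)
  refine lt_of_lt_of_le ?_ hle
  rw [setLIntegral_const]
  exact ENNReal.mul_pos (ENNReal.ofReal_pos.2 (by positivity)).ne' hν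

lemma exists_rpow_le_dyadic_avgKernel {r s : ℝ} (hr : r ∈ Ico (0:ℝ) 1) (hs : 0 ≤ s) :
    ∃ j : ℕ, (1 - r) ^ (-s) ≤ 2 * ((2:ℝ) ^ (j + 1)) ^ s * avgKernel (2 ^ j) r := by
  have hx : 0 < 1 - r := by linarith [hr.2]
  obtain ⟨j, hj1, hj2⟩ := exists_nat_pow_near (x := (1 - r)⁻¹) (y := 2)
    (one_le_inv_iff₀.2 ⟨hx, by linarith [hr.1]⟩) one_lt_two
  refine ⟨j, ?_⟩
  have hK : 1 / 2 ≤ avgKernel (2 ^ j) r := by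
    refine half_le_avgKernel (by positivity) hr ?_
    push_cast
    calc (2:ℝ) ^ j * (1 - r) ≤ (1 - r)⁻¹ * (1 - r) := by gcongr
      _ = 1 := inv_mul_cancel₀ hx.ne'
  have hle : (1 - r) ^ (-s) ≤ ((2:ℝ) ^ (j + 1)) ^ s := by
    rw [Real.rpow_neg hx.le, ← Real.inv_rpow hx.le]
    exact Real.rpow_le_rpow (by positivity) hj2.le hs
  have : 0 ≤ ((2:ℝ) ^ (j + 1)) ^ s := by positivity
  nlinarith

lemma lintegral_lt_top_of_eventually_mseq_le {ν : Measure ℝ} [IsFiniteMeasure ν]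
    (h1 : ν {1} = 0) {s t : ℝ} (hs : 0 ≤ s) (hst : s < t)
    (h : ∀ᶠ n : ℕ in Filter.atTop, mseq ν n ≤ ((n : ℝ) + 1) ^ (-t)) :
    ∫⁻ r in Icc (0:ℝ) 1, (ENNReal.ofReal (1 - r)) ^ (-s) ∂ν < ⊤ := by
  have hpred : ∀ j : ℕ, 2 ^ j - 1 + 1 = 2 ^ j := fun j => Nat.sub_add_cancel Nat.one_le_two_pow
  set a : ℕ → ℝ := fun j => 2 * ((2:ℝ) ^ (j + 1)) ^ s * mseq ν (2 ^ j - 1) with ha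
  have htend : Filter.Tendsto (fun j : ℕ => 2 ^ j - 1) Filter.atTop Filter.atTop :=
    Filter.tendsto_atTop_mono (fun j => Nat.le_sub_one_of_lt Nat.lt_two_pow_self) Filter.tendsto_id
  have hsum : Summable a := by
    have hgeom : Summable fun j : ℕ => 2 * (2:ℝ) ^ s * ((2:ℝ) ^ (s - t)) ^ j :=
      (summable_geometric_of_lt_one (by positivity)
        (Real.rpow_lt_one_of_one_lt_of_neg one_lt_two (by linarith))).mul_left _
    refine Summable.of_norm_bounded_eventually_nat hgeom ?_
    filter_upwards [htend.eventually h] with j hj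
    have hc : ((2 ^ j - 1 : ℕ) : ℝ) + 1 = 2 ^ j := by exact_mod_cast hpred j
    rw [hc] at hj
    rw [Real.norm_of_nonneg (mul_nonneg (by positivity) (mseq_nonneg _ _))]
    calc a j ≤ 2 * ((2:ℝ) ^ (j + 1)) ^ s * ((2:ℝ) ^ j) ^ (-t) := by
          simp only [ha]; gcongr
      _ = 2 * (2:ℝ) ^ s * ((2:ℝ) ^ (s - t)) ^ j := by
          simp only [← Real.rpow_natCast, ← Real.rpow_mul zero_le_two, mul_assoc,
            ← Real.rpow_add two_pos]
          push_cast
          ring_nf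
  have hmeas (j : ℕ) : Measurable fun r => ENNReal.ofReal (avgKernel (2 ^ j) r) :=
    (measurable_avgKernel _).ennreal_ofReal
  calc ∫⁻ r in Icc (0:ℝ) 1, (ENNReal.ofReal (1 - r)) ^ (-s) ∂ν
      ≤ ∫⁻ r in Icc (0:ℝ) 1, ∑' j : ℕ, ENNReal.ofReal (2 * ((2:ℝ) ^ (j + 1)) ^ s) *
          ENNReal.ofReal (avgKernel (2 ^ j) r) ∂ν := by
        refine lintegral_mono_ae ?_
        filter_upwards [ae_mem_Ico h1] with r hr
        obtain ⟨j, hj⟩ := exists_rpow_le_dyadic_avgKernel hr hs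
        refine le_trans ?_ (ENNReal.le_tsum j)
        rw [ENNReal.ofReal_rpow_of_pos (by linarith [hr.2]), ← ENNReal.ofReal_mul (by positivity)]
        exact ENNReal.ofReal_le_ofReal hj
    _ = ∑' j : ℕ, ENNReal.ofReal (a j) := by
        rw [lintegral_tsum fun j => ((hmeas j).const_mul _).aemeasurable]
        congr 1 with j
        rw [lintegral_const_mul _ (hmeas j), ha]
        simp only
        rw [ENNReal.ofReal_mul (p := 2 * ((2:ℝ) ^ (j + 1)) ^ s) (by positivity), ofReal_mseq, hpred]
    _ < ⊤ := hsum.tsum_ofReal_lt_top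

lemma bddAbove_sZero_set (ν : Measure ℝ) : BddAbove {s : ℝ | s ∈ Ico (0:ℝ) 1 ∧
    ∫⁻ r in Icc (0:ℝ) 1, (ENNReal.ofReal (1 - r)) ^ (-s) ∂ν < ⊤} :=
  ⟨1, fun _ hs => hs.1.2.le⟩

lemma eventually_log_pos : ∀ᶠ n : ℕ in Filter.atTop, 0 < Real.log ((n : ℝ) + 1) := by
  filter_upwards [Filter.eventually_ge_atTop 1] with n hn
  apply Real.log_pos
  have : (1:ℝ) ≤ n := by exact_mod_cast hn
  linarith

lemma tendsto_log_nat_add_one :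
    Filter.Tendsto (fun n : ℕ => Real.log ((n : ℝ) + 1)) Filter.atTop Filter.atTop :=
  Real.tendsto_log_atTop.comp
    (Filter.tendsto_atTop_add_const_right _ _ tendsto_natCast_atTop_atTop)

lemma eventually_log_mseq_div_log_le {ν : Measure ℝ} [IsFiniteMeasure ν] (h1 : ν {1} = 0)
    (hs0 : 0 < sZero ν) (hs1 : sZero ν < 1) {ε : ℝ} (hε : 0 < ε) :
    ∀ᶠ n : ℕ in Filter.atTop,
      Real.log (mseq ν n) / Real.log ((n : ℝ) + 1) ≤ -sZero ν + ε := by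
  have hne : {s : ℝ | s ∈ Ico (0:ℝ) 1 ∧
      ∫⁻ r in Icc (0:ℝ) 1, (ENNReal.ofReal (1 - r)) ^ (-s) ∂ν < ⊤}.Nonempty := by
    by_contra h
    rw [not_nonempty_iff_eq_empty] at h
    rw [sZero, h, Real.sSup_empty] at hs0
    exact hs0.false
  obtain ⟨s, ⟨hs, hI⟩, hlt⟩ := exists_lt_of_lt_csSup hne
    (show sZero ν - ε / 2 < _ from by change _ < sZero ν; linarith)
  obtain ⟨C, hC, hle⟩ := mseq_le_rpow h1 hs hI
  filter_upwards [eventually_log_pos,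
    tendsto_log_nat_add_one.eventually_ge_atTop (Real.log C / (ε / 2))] with n hpos hbig
  have hlog := Real.log_le_log (mseq_pos h1 hs1 n) (hle n)
  rw [Real.log_mul hC.ne' (by positivity), Real.log_rpow (by positivity)] at hlog
  rw [div_le_iff₀ (by positivity)] at hbig
  rw [div_le_iff₀ hpos]
  nlinarith

lemma frequently_le_log_mseq_div_log {ν : Measure ℝ} [IsFiniteMeasure ν] (h1 : ν {1} = 0)
    (hs0 : 0 < sZero ν) (hs1 : sZero ν < 1) {ε : ℝ} (hε : 0 < ε) :
    ∃ᶠ n : ℕ in Filter.atTop,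
      -sZero ν - ε ≤ Real.log (mseq ν n) / Real.log ((n : ℝ) + 1) := by
  intro hcon
  obtain ⟨s, hs, hs'⟩ := exists_between (lt_min hs1 (lt_add_of_pos_right (sZero ν) hε))
  have hfin := lintegral_lt_top_of_eventually_mseq_le (s := s) (t := sZero ν + ε) h1
    (hs0.trans hs).le (hs'.trans_le (min_le_right _ _)) (by
      filter_upwards [hcon, eventually_log_pos] with n hn hpos
      rw [not_le, div_lt_iff₀ hpos] at hn
      rw [← Real.log_le_log_iff (mseq_pos h1 hs1 n) (by positivity),
        Real.log_rpow (by positivity)]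
      linarith)
  exact hs.not_ge (le_csSup (bddAbove_sZero_set ν)
    ⟨⟨(hs0.trans hs).le, hs'.trans_le (min_le_left _ _)⟩, hfin⟩)

/-- **Proposition (growth of the multiplier sequence).**
If ν({1}) = 0 and 0 < s₀ < 1, then `limsup_{n→∞} log(m_n)/log(n+1) = -s₀`. -/
theorem multiplier_log_limsup
    (ν : Measure ℝ) [IsFiniteMeasure ν] (hsupp : ν (Icc (0:ℝ) 1)ᶜ = 0)
    (h1 : ν {1} = 0) (hs0 : 0 < sZero ν) (hs1 : sZero ν < 1) :
    Filter.limsup (fun n : ℕ => Real.log (mseq ν n) / Real.log ((n : ℝ) + 1))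
      Filter.atTop = -sZero ν := by
  have hub {ε : ℝ} (hε : 0 < ε) := eventually_log_mseq_div_log_le h1 hs0 hs1 hε
  have hlb {ε : ℝ} (hε : 0 < ε) := frequently_le_log_mseq_div_log h1 hs0 hs1 hε
  apply le_antisymm
  · refine le_of_forall_pos_le_add fun ε hε => ?_
    exact Filter.limsup_le_of_le
      (Filter.IsCoboundedUnder.of_frequently_ge (hlb one_pos)) (hub hε)
  · refine le_of_forall_pos_le_add fun ε hε => ?_
    have := Filter.le_limsup_of_frequently_le (hlb hε)
      (Filter.isBoundedUnder_of_eventually_le (hub one_pos))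
    linarith

end
end

section
/- Let ν be a finite positive Borel measure on [0,1] with ν({1}) = 0, and let 0 < s < 1. Then ∫₀¹ (1−r)^{−s} dν(r) < ∞ if and only if the series ∑_{n=0}^∞ m_n (n+1)^{s−1} converges. -/
open MeasureTheory Set ENNReal

noncomputable section

lemma mul_rpow_sub_one_le_rpow_sub {s x : ℝ} (hs0 : 0 ≤ s) (hs1 : s ≤ 1) (hx : 0 ≤ x) :
    s * (x + 1) ^ (s - 1) ≤ (x + 1) ^ s - x ^ s := by
  have hx1 : 0 < x + 1 := by linarith
  have hu : -1 ≤ -(1 / (x + 1)) := by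
    rw [neg_le_neg_iff, div_le_one hx1]
    linarith
  have h := rpow_one_add_le_one_add_mul_self hu hs0 hs1
  have hdiv : 1 + -(1 / (x + 1)) = x / (x + 1) := by field_simp; ring
  rw [hdiv, Real.div_rpow hx hx1.le, div_le_iff₀ (by positivity)] at h
  rw [Real.rpow_sub_one hx1.ne']
  have he : (1 + s * -(1 / (x + 1))) * (x + 1) ^ s
      = (x + 1) ^ s - s * ((x + 1) ^ s / (x + 1)) := by
    field_simp
    ring
  linarith

lemma mul_rpow_sub_one_div_le_rpow_sub {s x : ℝ} (hs0 : 0 ≤ s) (hs1 : s ≤ 1) (hx : 0 < x) :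
    (1 - s) * ((x + 1) ^ (s - 1) / (x + 1)) ≤ x ^ (s - 1) - (x + 1) ^ (s - 1) := by
  have hx1 : 0 < x + 1 := by linarith
  have hu : -1 ≤ -(1 / (x + 1)) := by
    rw [neg_le_neg_iff, div_le_one hx1]
    linarith
  have h := rpow_one_add_le_one_add_mul_self hu (sub_nonneg.2 hs1) (sub_le_self 1 hs0)
  have hdiv : 1 + -(1 / (x + 1)) = x / (x + 1) := by field_simp; ring
  rw [hdiv, Real.div_rpow hx.le hx1.le, ← neg_sub s 1, Real.rpow_neg hx.le,
    Real.rpow_neg hx1.le, inv_div_inv, div_le_iff₀ (by positivity)] at h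
  set a := x ^ (s - 1)
  set b := (x + 1) ^ (s - 1)
  have ha : 0 < a := by positivity
  have hv : (0 : ℝ) ≤ (1 - s) / (x + 1) := div_nonneg (by linarith) hx1.le
  have h' : b ≤ (1 - (1 - s) / (x + 1)) * a := by
    refine h.trans_eq ?_
    ring
  have h2 := mul_le_mul_of_nonneg_left h' (by linarith : 0 ≤ 1 + (1 - s) / (x + 1))
  have he : (1 - s) * (b / (x + 1)) = (1 - s) / (x + 1) * b := by ring
  rw [he]
  nlinarith [mul_nonneg (mul_nonneg hv hv) ha.le]

lemma sum_range_rpow_sub_one_le {s : ℝ} (hs0 : 0 < s) (hs1 : s ≤ 1) (N : ℕ) :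
    ∑ n ∈ Finset.range N, ((n : ℝ) + 1) ^ (s - 1) ≤ (N : ℝ) ^ s / s := by
  induction N with
  | zero => simp [Real.zero_rpow hs0.ne']
  | succ N ih =>
    rw [Finset.sum_range_succ]
    have h := mul_rpow_sub_one_le_rpow_sub hs0.le hs1 (Nat.cast_nonneg N)
    rw [le_div_iff₀ hs0] at ih ⊢
    push_cast
    linarith

lemma sum_range_shift_rpow_sub_one_div_le {s : ℝ} (hs0 : 0 ≤ s) (hs1 : s < 1) {N : ℕ}
    (hN : 0 < N) (K : ℕ) :
    ∑ k ∈ Finset.range K, (((N + k : ℕ) : ℝ) + 1) ^ (s - 1) / (((N + k : ℕ) : ℝ) + 1)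
      ≤ (N : ℝ) ^ (s - 1) / (1 - s) := by
  have hs : 0 < 1 - s := by linarith
  suffices h : (1 - s) *
      ∑ k ∈ Finset.range K, (((N + k : ℕ) : ℝ) + 1) ^ (s - 1) / (((N + k : ℕ) : ℝ) + 1)
      ≤ (N : ℝ) ^ (s - 1) - ((N + K : ℕ) : ℝ) ^ (s - 1) by
    rw [le_div_iff₀' hs]
    have : 0 ≤ ((N + K : ℕ) : ℝ) ^ (s - 1) := by positivity
    linarith
  have htele := Finset.sum_range_sub' (fun k => ((N + k : ℕ) : ℝ) ^ (s - 1)) K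
  rw [add_zero] at htele
  rw [Finset.mul_sum, ← htele]
  refine Finset.sum_le_sum fun k _ => ?_
  have h := mul_rpow_sub_one_div_le_rpow_sub hs0 hs1.le
    (by positivity : (0 : ℝ) < ((N + k : ℕ) : ℝ))
  simpa [add_assoc] using h

/-- The quotient `(1 - r^{n+1})/(1 - r)`, weighted by `(n+1)^{s-2}`. -/
def weightedQuotient (s r : ℝ) (n : ℕ) : ℝ :=
  ((n : ℝ) + 1) ^ (s - 1) / ((n : ℝ) + 1) * ((1 - r ^ (n + 1)) / (1 - r))

lemma one_sub_pow_div_eq_geom_sum {r : ℝ} (hr : r ≠ 1) (n : ℕ) :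
    (1 - r ^ n) / (1 - r) = ∑ k ∈ Finset.range n, r ^ k := by
  rw [geom_sum_eq hr, ← neg_sub, ← neg_sub r 1, neg_div_neg_eq]

lemma one_sub_pow_div_nonneg {r : ℝ} (h0 : 0 ≤ r) (n : ℕ) :
    0 ≤ (1 - r ^ n) / (1 - r) := by
  rcases eq_or_ne r 1 with rfl | hr
  · simp
  · rw [one_sub_pow_div_eq_geom_sum hr]
    positivity

lemma one_sub_pow_div_le {r : ℝ} (h0 : 0 ≤ r) (h1 : r ≤ 1) (n : ℕ) :
    (1 - r ^ n) / (1 - r) ≤ n := by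
  rcases eq_or_ne r 1 with rfl | hr
  · simp
  · rw [one_sub_pow_div_eq_geom_sum hr]
    calc ∑ k ∈ Finset.range n, r ^ k ≤ ∑ k ∈ Finset.range n, (1 : ℝ) :=
          Finset.sum_le_sum fun k _ => pow_le_one₀ h0 h1
      _ = n := by simp

lemma half_le_one_sub_pow_div {r : ℝ} (h0 : 0 ≤ r) (h1 : r < 1) {n : ℕ}
    (hn : n * (1 - r) ≤ 1) :
    ((n : ℝ) + 1) / 2 ≤ (1 - r ^ (n + 1)) / (1 - r) := by
  have key : ∀ m : ℕ, ((m : ℝ) + 1) * (1 - m * (1 - r) / 2)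
      ≤ ∑ k ∈ Finset.range (m + 1), r ^ k := by
    intro m
    induction m with
    | zero => simp
    | succ m ih =>
      rw [Finset.sum_range_succ]
      have hb := one_add_mul_le_pow (by linarith : (-2 : ℝ) ≤ -(1 - r)) (m + 1)
      have he : 1 + -(1 - r) = r := by ring
      rw [he] at hb
      push_cast at hb ⊢
      nlinarith
  rw [one_sub_pow_div_eq_geom_sum h1.ne]
  refine le_trans ?_ (key n)
  have : (0 : ℝ) ≤ n := Nat.cast_nonneg n
  nlinarith

lemma weightedQuotient_nonneg {s r : ℝ} (h0 : 0 ≤ r) (n : ℕ) : 0 ≤ weightedQuotient s r n :=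
  mul_nonneg (by positivity) (one_sub_pow_div_nonneg h0 _)

lemma sum_range_weightedQuotient_le {s r : ℝ} (hs0 : 0 < s) (hs1 : s < 1)
    (h0 : 0 ≤ r) (h1 : r < 1) (K : ℕ) :
    ∑ n ∈ Finset.range K, weightedQuotient s r n
      ≤ (1 / s + 2 / (1 - s)) * (1 - r) ^ (-s) := by
  have ht : 0 < 1 - r := by linarith
  have hs : 0 < 1 - s := by linarith
  set T := (1 - r)⁻¹ with hT
  have hT1 : 1 ≤ T := (one_le_inv₀ ht).2 (by linarith)
  have hT0 : 0 < T := by linarith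
  set N := ⌊T⌋₊ with hNdef
  have hN : 0 < N := Nat.floor_pos.2 hT1
  have hNR : (1 : ℝ) ≤ N := by exact_mod_cast hN
  have hNT : (N : ℝ) ≤ T := Nat.floor_le hT0.le
  have hTN : T ≤ 2 * N := by
    have := Nat.lt_floor_add_one T
    linarith
  have hpow : (N : ℝ) ^ s ≤ T ^ s := Real.rpow_le_rpow (by positivity) hNT hs0.le
  have hhead : ∑ n ∈ Finset.range N, weightedQuotient s r n ≤ T ^ s / s := by
    refine le_trans (Finset.sum_le_sum fun n _ => ?_)
      ((sum_range_rpow_sub_one_le hs0 hs1.le N).trans (by gcongr))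
    have h := one_sub_pow_div_le h0 h1.le (n + 1)
    push_cast at h
    calc weightedQuotient s r n
        ≤ ((n : ℝ) + 1) ^ (s - 1) / ((n : ℝ) + 1) * ((n : ℝ) + 1) :=
          mul_le_mul_of_nonneg_left h (by positivity)
      _ = ((n : ℝ) + 1) ^ (s - 1) := by field_simp
  have htail : ∑ k ∈ Finset.range K, weightedQuotient s r (N + k) ≤ 2 * T ^ s / (1 - s) := by
    have hterm : ∀ n, weightedQuotient s r n ≤ ((n : ℝ) + 1) ^ (s - 1) / ((n : ℝ) + 1) * T := by
      intro n
      refine mul_le_mul_of_nonneg_left ?_ (by positivity)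
      rw [hT, div_eq_mul_inv]
      refine mul_le_of_le_one_left (by positivity) ?_
      linarith [pow_nonneg h0 (n + 1)]
    calc ∑ k ∈ Finset.range K, weightedQuotient s r (N + k)
        ≤ ∑ k ∈ Finset.range K,
          (((N + k : ℕ) : ℝ) + 1) ^ (s - 1) / (((N + k : ℕ) : ℝ) + 1) * T :=
          Finset.sum_le_sum fun k _ => hterm _
      _ ≤ (N : ℝ) ^ (s - 1) / (1 - s) * T := by
          rw [← Finset.sum_mul]
          exact mul_le_mul_of_nonneg_right
            (sum_range_shift_rpow_sub_one_div_le hs0.le hs1 hN K) hT0.le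
      _ = (N : ℝ) ^ s * (T / N) / (1 - s) := by
          rw [Real.rpow_sub_one (by positivity)]
          ring
      _ ≤ T ^ s * 2 / (1 - s) := by
          gcongr
          rwa [div_le_iff₀ (by positivity)]
      _ = 2 * T ^ s / (1 - s) := by ring
  have hmono : ∑ n ∈ Finset.range K, weightedQuotient s r n
      ≤ ∑ n ∈ Finset.range (N + K), weightedQuotient s r n :=
    Finset.sum_le_sum_of_subset_of_nonneg (Finset.range_mono (by omega))
      fun n _ _ => weightedQuotient_nonneg h0 n
  rw [Finset.sum_range_add] at hmono
  have hTs : (1 - r) ^ (-s) = T ^ s := by rw [Real.rpow_neg ht.le, hT, Real.inv_rpow ht.le]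
  rw [hTs]
  calc _ ≤ T ^ s / s + 2 * T ^ s / (1 - s) := by linarith
    _ = _ := by ring

lemma rpow_neg_le_sum_range_weightedQuotient {s r : ℝ} (hs0 : 0 ≤ s) (hs1 : s ≤ 1)
    (h0 : 0 ≤ r) (h1 : r < 1) :
    ∃ K : ℕ, (1 - r) ^ (-s) ≤ 2 * ∑ n ∈ Finset.range K, weightedQuotient s r n := by
  have ht : 0 < 1 - r := by linarith
  set T := (1 - r)⁻¹ with hT
  have hT0 : 0 < T := by positivity
  set M := ⌊T⌋₊ with hM
  have hMT : (M : ℝ) ≤ T := Nat.floor_le hT0.le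
  have hTM : T ≤ (M : ℝ) + 1 := (Nat.lt_floor_add_one T).le
  refine ⟨M + 1, ?_⟩
  have hterm : ∀ n ∈ Finset.range (M + 1),
      ((M : ℝ) + 1) ^ (s - 1) / 2 ≤ weightedQuotient s r n := by
    intro n hn
    have hnM : (n : ℝ) ≤ M := by exact_mod_cast Nat.lt_succ_iff.1 (Finset.mem_range.1 hn)
    have hnt : n * (1 - r) ≤ 1 := by
      rw [← le_div_iff₀ ht, one_div]
      exact hnM.trans hMT
    calc ((M : ℝ) + 1) ^ (s - 1) / 2 ≤ ((n : ℝ) + 1) ^ (s - 1) / 2 := by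
          gcongr ?_ / 2
          exact Real.rpow_le_rpow_of_nonpos (by positivity) (by linarith) (by linarith)
      _ = ((n : ℝ) + 1) ^ (s - 1) / ((n : ℝ) + 1) * (((n : ℝ) + 1) / 2) := by field_simp
      _ ≤ weightedQuotient s r n :=
          mul_le_mul_of_nonneg_left (half_le_one_sub_pow_div h0 h1 hnt) (by positivity)
  have hsum := Finset.card_nsmul_le_sum _ _ _ hterm
  rw [Finset.card_range, nsmul_eq_mul, Real.rpow_sub_one (by positivity)] at hsum
  push_cast at hsum
  have he : ((M : ℝ) + 1) * (((M : ℝ) + 1) ^ s / ((M : ℝ) + 1) / 2) = ((M : ℝ) + 1) ^ s / 2 := by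
    field_simp
  rw [he] at hsum
  have hTs : (1 - r) ^ (-s) = T ^ s := by rw [Real.rpow_neg ht.le, hT, Real.inv_rpow ht.le]
  rw [hTs]
  linarith [Real.rpow_le_rpow hT0.le hTM hs0]

lemma tsum_ofReal_weightedQuotient_le {s r : ℝ} (hs0 : 0 < s) (hs1 : s < 1)
    (h0 : 0 ≤ r) (h1 : r < 1) :
    ∑' n, ENNReal.ofReal (weightedQuotient s r n)
      ≤ ENNReal.ofReal (1 / s + 2 / (1 - s)) * ENNReal.ofReal (1 - r) ^ (-s) := by
  have hs : 0 < 1 - s := by linarith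
  refine ENNReal.tsum_le_of_sum_range_le fun K => ?_
  rw [← ENNReal.ofReal_sum_of_nonneg fun n _ => weightedQuotient_nonneg h0 n,
    ENNReal.ofReal_rpow_of_pos (by linarith), ← ENNReal.ofReal_mul (by positivity)]
  exact ENNReal.ofReal_le_ofReal (sum_range_weightedQuotient_le hs0 hs1 h0 h1 K)

lemma rpow_neg_le_tsum_ofReal_weightedQuotient {s r : ℝ} (hs0 : 0 ≤ s) (hs1 : s ≤ 1)
    (h0 : 0 ≤ r) (h1 : r < 1) :
    ENNReal.ofReal (1 - r) ^ (-s)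
      ≤ 2 * ∑' n, ENNReal.ofReal (weightedQuotient s r n) := by
  obtain ⟨K, hK⟩ := rpow_neg_le_sum_range_weightedQuotient hs0 hs1 h0 h1
  calc ENNReal.ofReal (1 - r) ^ (-s)
      ≤ ENNReal.ofReal (2 * ∑ n ∈ Finset.range K, weightedQuotient s r n) := by
        rw [ENNReal.ofReal_rpow_of_pos (by linarith)]
        exact ENNReal.ofReal_le_ofReal hK
    _ = 2 * ∑ n ∈ Finset.range K, ENNReal.ofReal (weightedQuotient s r n) := by
        rw [ENNReal.ofReal_mul zero_le_two,
          ENNReal.ofReal_sum_of_nonneg fun n _ => weightedQuotient_nonneg h0 n,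
          ENNReal.ofReal_ofNat]
    _ ≤ _ := by gcongr; exact ENNReal.sum_le_tsum _

lemma measurable_weightedQuotient (s : ℝ) (n : ℕ) :
    Measurable fun r => weightedQuotient s r n := by
  unfold weightedQuotient
  fun_prop

lemma mseq_mul_rpow_eq_integral (ν : Measure ℝ) (s : ℝ) (n : ℕ) :
    mseq ν n * ((n : ℝ) + 1) ^ (s - 1) = ∫ r in Icc (0:ℝ) 1, weightedQuotient s r n ∂ν := by
  unfold mseq weightedQuotient
  rw [integral_const_mul]
  ring

lemma mseq_mul_rpow_nonneg (ν : Measure ℝ) (s : ℝ) (n : ℕ) :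
    0 ≤ mseq ν n * ((n : ℝ) + 1) ^ (s - 1) := by
  rw [mseq_mul_rpow_eq_integral]
  exact setIntegral_nonneg measurableSet_Icc fun r hr => weightedQuotient_nonneg hr.1 n

lemma ofReal_mseq_mul_rpow (ν : Measure ℝ) [IsFiniteMeasure ν] (s : ℝ) (n : ℕ) :
    ENNReal.ofReal (mseq ν n * ((n : ℝ) + 1) ^ (s - 1))
      = ∫⁻ r in Icc (0:ℝ) 1, ENNReal.ofReal (weightedQuotient s r n) ∂ν := by
  rw [mseq_mul_rpow_eq_integral]
  have hmem : ∀ᵐ r ∂ν.restrict (Icc (0:ℝ) 1), r ∈ Icc (0:ℝ) 1 :=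
    ae_restrict_mem measurableSet_Icc
  refine ofReal_integral_eq_lintegral_ofReal ?_ ?_
  · refine Integrable.of_bound (measurable_weightedQuotient s n).aestronglyMeasurable
      (((n : ℝ) + 1) ^ (s - 1) / ((n : ℝ) + 1) * ((n + 1 : ℕ) : ℝ)) ?_
    filter_upwards [hmem] with r hr
    rw [Real.norm_of_nonneg (weightedQuotient_nonneg hr.1 n)]
    exact mul_le_mul_of_nonneg_left (one_sub_pow_div_le hr.1 hr.2 _) (by positivity)
  · filter_upwards [hmem] with r hr using weightedQuotient_nonneg hr.1 n

lemma summable_iff_tsum_ofReal_lt_top {f : ℕ → ℝ} (hf : ∀ n, 0 ≤ f n) :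
    Summable f ↔ ∑' n, ENNReal.ofReal (f n) < ⊤ := by
  refine ⟨fun h => h.tsum_ofReal_lt_top, fun h => ?_⟩
  simpa only [ENNReal.toReal_ofReal (hf _)] using ENNReal.summable_toReal h.ne

/-- **Lemma (integral–series equivalence).**
If ν({1}) = 0 and 0 < s < 1, then `∫₀¹ (1-r)^{-s} dν(r) < ∞` iff
`∑_{n=0}^∞ m_n (n+1)^{s-1}` converges. -/
theorem multiplier_integral_series_equivalence
    (ν : Measure ℝ) [IsFiniteMeasure ν] (hsupp : ν (Icc (0:ℝ) 1)ᶜ = 0)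
    (h1 : ν {1} = 0) (s : ℝ) (hs0 : 0 < s) (hs1 : s < 1) :
    (∫⁻ r in Icc (0:ℝ) 1, (ENNReal.ofReal (1 - r)) ^ (-s) ∂ν < ⊤) ↔
      Summable (fun n : ℕ => mseq ν n * ((n : ℝ) + 1) ^ (s - 1)) := by
  rw [summable_iff_tsum_ofReal_lt_top (mseq_mul_rpow_nonneg ν s)]
  simp_rw [ofReal_mseq_mul_rpow]
  rw [← lintegral_tsum fun n => (measurable_weightedQuotient s n).ennreal_ofReal.aemeasurable]
  have hmem : ∀ᵐ r ∂ν.restrict (Icc (0:ℝ) 1), 0 ≤ r ∧ r < 1 := by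
    have hne : ∀ᵐ r ∂ν, r ≠ 1 := measure_eq_zero_iff_ae_notMem.1 h1
    filter_upwards [ae_restrict_mem measurableSet_Icc, ae_restrict_of_ae hne] with r hr hr1
    exact ⟨hr.1, lt_of_le_of_ne hr.2 hr1⟩
  constructor
  · intro h
    refine lt_of_le_of_lt (lintegral_mono_ae (hmem.mono fun r hr =>
      tsum_ofReal_weightedQuotient_le hs0 hs1 hr.1 hr.2)) ?_
    rw [lintegral_const_mul' _ _ ENNReal.ofReal_ne_top]
    exact ENNReal.mul_lt_top ENNReal.ofReal_lt_top h
  · intro h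
    refine lt_of_le_of_lt (lintegral_mono_ae (hmem.mono fun r hr =>
      rpow_neg_le_tsum_ofReal_weightedQuotient hs0.le hs1.le hr.1 hr.2)) ?_
    rw [lintegral_const_mul' _ _ ENNReal.ofNat_ne_top]
    exact ENNReal.mul_lt_top ENNReal.ofNat_lt_top h


end
end
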